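/- arXiv:1705.08362 — 8 statements merged into one kernel-verified Lean document; each statement's English description precedes it below -/
import Mathlib

section
/- Let C be a finitely complete category with coequalizers in which every morphism factors as a regular epimorphism followed by a monomorphism, and let H : C → C be an endofunctor preserving monomorphisms. If e₁ : (X,ξ) → (D₁,d₁) and e₂ : (X,ξ) → (D₂,d₂) are quotients of the H-coalgebra (X,ξ) (coalgebra morphisms whose underlying C-morphisms are regular epimorphisms) and both (D₁,d₁) and (D₂,d₂) are simple coalgebras, then there exists an isomorphism of coalgebras φ : (D₁,d₁) ≅ (D₂,d₂) with φ ∘ e₁ = e₂; i.e., the simple quotient of a coalgebra is unique up to isomorphism. -/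
open CategoryTheory CategoryTheory.Limits

universe v u

/-- A morphism from a coalgebra to a simple coalgebra factors through every quotient of its
domain. -/
theorem exists_factor_of_simple {C : Type u} [Category.{v} C] [HasCoequalizers C] (H : C ⥤ C)
    {X D₁ D₂ : C} {ξ : X ⟶ H.obj X} {d₁ : D₁ ⟶ H.obj D₁} {d₂ : D₂ ⟶ H.obj D₂}
    {e₁ : X ⟶ D₁} {e₂ : X ⟶ D₂}
    (he₁ : e₁ ≫ d₁ = ξ ≫ H.map e₁) (he₂ : e₂ ≫ d₂ = ξ ≫ H.map e₂) [IsRegularEpi e₁]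
    (hs₂ : ∀ (E : C) (dE : E ⟶ H.obj E) (g : D₂ ⟶ E),
      g ≫ dE = d₂ ≫ H.map g → Nonempty (RegularEpi g) → IsIso g) :
    ∃ φ : D₁ ⟶ D₂, φ ≫ d₂ = d₁ ≫ H.map φ ∧ e₁ ≫ φ = e₂ := by
  let r := IsRegularEpi.getStruct e₁
  -- The coequalizer `q` is the pushout of `e₁` along `e₂`.
  let q := coequalizer.π (r.left ≫ e₂) (r.right ≫ e₂)
  have hq : (r.left ≫ e₂) ≫ q = (r.right ≫ e₂) ≫ q := coequalizer.condition _ _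
  obtain ⟨p, hp⟩ : ∃ p, e₁ ≫ p = e₂ ≫ q :=
    ⟨_, (Cofork.IsColimit.desc' r.isColimit (e₂ ≫ q) (by simpa using hq)).2⟩
  have key : e₂ ≫ d₂ ≫ H.map q = e₁ ≫ d₁ ≫ H.map p := by
    rw [reassoc_of% he₁, reassoc_of% he₂, ← H.map_comp, ← H.map_comp, hp]
  have hdesc : (r.left ≫ e₂) ≫ d₂ ≫ H.map q = (r.right ≫ e₂) ≫ d₂ ≫ H.map q := by
    rw [Category.assoc, Category.assoc, key, reassoc_of% r.w]
  have : IsIso q := hs₂ _ (coequalizer.desc _ hdesc) q (coequalizer.π_desc _ _)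
    (inferInstance : IsRegularEpi q).regularEpi
  obtain ⟨φ, hφ⟩ : ∃ φ, e₁ ≫ φ = e₂ :=
    ⟨_, (Cofork.IsColimit.desc' r.isColimit e₂ ((cancel_mono q).1 hq)).2⟩
  have : Epi e₁ := r.epi
  refine ⟨φ, ?_, hφ⟩
  rw [← cancel_epi e₁, reassoc_of% hφ, reassoc_of% he₁, ← H.map_comp, hφ, he₂]

/-- **Uniqueness of the simple quotient of a coalgebra.**
`C` is finitely complete, has coequalizers, and every morphism factors as a regular
epimorphism followed by a monomorphism; `H` preserves monomorphisms.  If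
`e₁ : (X,ξ) → (D₁,d₁)` and `e₂ : (X,ξ) → (D₂,d₂)` are quotients (coalgebra morphisms
carried by regular epimorphisms) and both codomain coalgebras are simple (every quotient
of them is an isomorphism), then there is an isomorphism of coalgebras
`φ : (D₁,d₁) ≅ (D₂,d₂)` with `φ ∘ e₁ = e₂`. -/
theorem stmt_0 {C : Type u} [Category.{v} C] [HasFiniteLimits C] [HasCoequalizers C]
    (hfact : ∀ {A B : C} (f : A ⟶ B), ∃ (I : C) (e : A ⟶ I) (m : I ⟶ B),
      Nonempty (RegularEpi e) ∧ Mono m ∧ e ≫ m = f)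
    (H : C ⥤ C)
    (hmono : ∀ {A B : C} (f : A ⟶ B), Mono f → Mono (H.map f))
    (X D₁ D₂ : C) (ξ : X ⟶ H.obj X) (d₁ : D₁ ⟶ H.obj D₁) (d₂ : D₂ ⟶ H.obj D₂)
    (e₁ : X ⟶ D₁) (e₂ : X ⟶ D₂)
    (he₁ : e₁ ≫ d₁ = ξ ≫ H.map e₁) (he₂ : e₂ ≫ d₂ = ξ ≫ H.map e₂)
    (re₁ : Nonempty (RegularEpi e₁)) (re₂ : Nonempty (RegularEpi e₂))
    (hs₁ : ∀ (E : C) (dE : E ⟶ H.obj E) (g : D₁ ⟶ E),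
      g ≫ dE = d₁ ≫ H.map g → Nonempty (RegularEpi g) → IsIso g)
    (hs₂ : ∀ (E : C) (dE : E ⟶ H.obj E) (g : D₂ ⟶ E),
      g ≫ dE = d₂ ≫ H.map g → Nonempty (RegularEpi g) → IsIso g) :
    ∃ φ : D₁ ≅ D₂, φ.hom ≫ d₂ = d₁ ≫ H.map φ.hom ∧ e₁ ≫ φ.hom = e₂ := by
  have : IsRegularEpi e₁ := ⟨re₁⟩
  have : IsRegularEpi e₂ := ⟨re₂⟩
  obtain ⟨φ, hφ, hφe⟩ := exists_factor_of_simple H he₁ he₂ hs₂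
  obtain ⟨ψ, -, hψe⟩ := exists_factor_of_simple H he₂ he₁ hs₁
  have : Epi e₁ := re₁.some.epi
  have : Epi e₂ := re₂.some.epi
  exact ⟨⟨φ, ψ, by simp [← cancel_epi e₁, reassoc_of% hφe, hψe],
    by simp [← cancel_epi e₂, reassoc_of% hψe, hφe]⟩, hφ, hφe⟩
end

section
/- Let C be a finitely complete category that has coequalizers. Then C has pushouts of regular epimorphisms: for every regular epimorphism e : Y → X and every morphism h : Y → W in C, the pushout of e and h exists. Moreover, constructing q : W → Z as the coequalizer of h∘π₁ and h∘π₂ (where (π₁,π₂) is the kernel pair of e) and r : X → Z as the induced morphism with r∘e = q∘h yields such a pushout square. -/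
open CategoryTheory CategoryTheory.Limits

universe v u

/-- A morphism coequalizing the kernel pair of a regular epimorphism `e` factors through `e`. -/
lemma CategoryTheory.RegularEpi.exists_fac_of_kernelPair {C : Type u} [Category.{v} C]
    {X Y Z : C} {e : Y ⟶ X}
    [HasPullback e e] (re : RegularEpi e) (k : Y ⟶ Z)
    (hk : pullback.fst e e ≫ k = pullback.snd e e ≫ k) : ∃ r : X ⟶ Z, e ≫ r = k := by
  have w : re.left ≫ k = re.right ≫ k := by
    rw [← pullback.lift_fst re.left re.right re.w, Category.assoc, hk, ← Category.assoc,
      pullback.lift_snd]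
  exact ⟨re.isColimit.desc (Cofork.ofπ k w), re.isColimit.fac _ WalkingParallelPair.one⟩

/-- **Pushouts of regular epimorphisms exist.**
In a finitely complete category with coequalizers, for every regular epimorphism
`e : Y ⟶ X` and every morphism `h : Y ⟶ W` the pushout of `e` and `h` exists; moreover,
taking `q : W ⟶ Z` to be the coequalizer of `π₁ ≫ h` and `π₂ ≫ h` (where `(π₁, π₂)` is the
kernel pair of `e`) and `r : X ⟶ Z` the induced morphism with `e ≫ r = h ≫ q`
yields such a pushout square. -/
theorem stmt_1 {C : Type u} [Category.{v} C] [HasFiniteLimits C] [HasCoequalizers C]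
    {X Y W : C} (e : Y ⟶ X) (re : Nonempty (RegularEpi e)) (h : Y ⟶ W) :
    HasPushout e h ∧
      ∃ r : X ⟶ coequalizer (pullback.fst e e ≫ h) (pullback.snd e e ≫ h),
        e ≫ r = h ≫ coequalizer.π (pullback.fst e e ≫ h) (pullback.snd e e ≫ h) ∧
          IsPushout e h r (coequalizer.π (pullback.fst e e ≫ h) (pullback.snd e e ≫ h)) := by
  obtain ⟨re⟩ := re
  have : Epi e := RegularEpi.epi e re
  obtain ⟨r, hr⟩ := re.exists_fac_of_kernelPair
    (h ≫ coequalizer.π (pullback.fst e e ≫ h) (pullback.snd e e ≫ h))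
    (by simpa only [Category.assoc] using
      coequalizer.condition (pullback.fst e e ≫ h) (pullback.snd e e ≫ h))
  have hp : IsPushout e h r
      (coequalizer.π (pullback.fst e e ≫ h) (pullback.snd e e ≫ h)) :=
    ⟨⟨hr⟩, ⟨PushoutCocone.IsColimit.mk hr
      (fun s => coequalizer.desc s.inr (by
        rw [Category.assoc, Category.assoc, ← s.condition, pullback.condition_assoc]))
      (fun s => by
        rw [← cancel_epi e, ← Category.assoc, hr, Category.assoc, coequalizer.π_desc, s.condition])
      (fun s => coequalizer.π_desc _ _)
      (fun s m _ hm => coequalizer.hom_ext (by rw [hm, coequalizer.π_desc]))⟩⟩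
  exact ⟨hp.hasPushout, r, hr, hp⟩
end

section
/- In the generic partition refinement setup, for every i ≥ 0: the kernel pair P_{i+1} is finer than P_i, the kernel pair Q_{i+1} is finer than Q_i, and P_i is finer than Q_{i+1} (hence also finer than Q_i). -/
open CategoryTheory CategoryTheory.Limits

universe v u

noncomputable section

variable {C : Type u} [Category.{v} C] [HasFiniteLimits C] [HasCoequalizers C]

/-- The kernel pair of `f` is finer than the kernel pair of `g`: there is a morphism
between the kernel pairs commuting with the projections. -/
def Finer {X A B : C} (f : X ⟶ A) (g : X ⟶ B) : Prop :=
  ∃ m : pullback f f ⟶ pullback g g,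
    m ≫ pullback.fst g g = pullback.fst f f ∧ m ≫ pullback.snd g g = pullback.snd f f

variable (H : C ⥤ C) {X : C} (ξ : X ⟶ H.obj X) (K : ℕ → C) (q : ∀ i : ℕ, X ⟶ K i)

/-- `q̄ᵢ = ⟨q₀, …, qᵢ⟩ : X ⟶ ∏_{j ≤ i} K j`. -/
def qbar (i : ℕ) : X ⟶ ∏ᶜ (fun j : Fin (i + 1) => K j) :=
  Pi.lift fun j => q j

/-- The morphism whose kernel pair is `Qᵢ`. -/
def Qmor (i : ℕ) : X ⟶ ∏ᶜ (fun j : Fin (i + 1) => K j) := qbar K q i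

/-- The morphism whose kernel pair is `Pᵢ`. -/
def Pmor (i : ℕ) : X ⟶ H.obj (∏ᶜ (fun j : Fin (i + 1) => K j)) :=
  ξ ≫ H.map (qbar K q i)

/-- `X/Pᵢ`, the coequalizer of the kernel pair `Pᵢ ⇉ X`. -/
def XmodP (i : ℕ) : C :=
  coequalizer (pullback.fst (Pmor H ξ K q i) (Pmor H ξ K q i))
    (pullback.snd (Pmor H ξ K q i) (Pmor H ξ K q i))

/-- `κ_{Pᵢ} : X ↠ X/Pᵢ`. -/
def kappaP (i : ℕ) : X ⟶ XmodP H ξ K q i :=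
  coequalizer.π _ _

/-- `X/Qᵢ`, the coequalizer of the kernel pair `Qᵢ ⇉ X`. -/
def XmodQ (i : ℕ) : C :=
  coequalizer (pullback.fst (Qmor K q i) (Qmor K q i))
    (pullback.snd (Qmor K q i) (Qmor K q i))

/-- `κ_{Qᵢ} : X ↠ X/Qᵢ`. -/
def kappaQ (i : ℕ) : X ⟶ XmodQ K q i :=
  coequalizer.π _ _

theorem Finer.of_comp_eq {X A B : C} {f : X ⟶ A} {g : X ⟶ B}
    (h : pullback.fst f f ≫ g = pullback.snd f f ≫ g) : Finer f g :=
  ⟨pullback.lift _ _ h, pullback.lift_fst _ _ h, pullback.lift_snd _ _ h⟩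

theorem Finer.comp_right {X A B : C} (f : X ⟶ A) (g : A ⟶ B) : Finer f (f ≫ g) :=
  .of_comp_eq (pullback.condition_assoc g)

theorem Finer.comp_coequalizer_eq {X A B D : C} {f : X ⟶ A} {g : X ⟶ B} (h : Finer f g)
    (k : coequalizer (pullback.fst g g) (pullback.snd g g) ⟶ D) :
    pullback.fst f f ≫ coequalizer.π _ _ ≫ k = pullback.snd f f ≫ coequalizer.π _ _ ≫ k := by
  obtain ⟨m, h₁, h₂⟩ := h
  rw [← h₁, ← h₂, Category.assoc, Category.assoc, coequalizer.condition_assoc]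

/-- The projection `∏_{l ≤ i} K l ⟶ ∏_{l ≤ j} K l` for `j ≤ i`. -/
def truncate {i j : ℕ} (h : j ≤ i) :
    ∏ᶜ (fun l : Fin (i + 1) => K l) ⟶ ∏ᶜ (fun l : Fin (j + 1) => K l) :=
  Pi.lift fun l => Pi.π (fun l : Fin (i + 1) => K l) (l.castLE (Nat.succ_le_succ h))

theorem qbar_truncate {i j : ℕ} (h : j ≤ i) : qbar K q i ≫ truncate K h = qbar K q j := by
  refine Pi.hom_ext _ _ fun l => ?_
  simp [qbar, truncate]

theorem finer_Qmor {i j : ℕ} (h : j ≤ i) : Finer (Qmor K q i) (Qmor K q j) := by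
  have := Finer.comp_right (Qmor K q i) (truncate K h)
  rwa [Qmor, qbar_truncate] at this

theorem finer_Pmor {i j : ℕ} (h : j ≤ i) : Finer (Pmor H ξ K q i) (Pmor H ξ K q j) := by
  have := Finer.comp_right (Pmor H ξ K q i) (H.map (truncate K h))
  rwa [Pmor, Category.assoc, ← H.map_comp, qbar_truncate] at this

theorem Finer.Qmor_of_forall {A : C} {f : X ⟶ A} {i : ℕ}
    (h : ∀ j ≤ i, pullback.fst f f ≫ q j = pullback.snd f f ≫ q j) : Finer f (Qmor K q i) := by
  refine .of_comp_eq (Pi.hom_ext _ _ fun j => ?_)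
  simpa [Qmor, qbar] using h j (Nat.le_of_lt_succ j.isLt)

/-- **Successive refinement.**  In the generic partition refinement setup
(with regular epi–mono factorizations, `H` preserving monos, `K 0` terminal and
`q_{i+1} = k_{i+1} ∘ κ_{Pᵢ}` for the given select data `k`), for every `i ≥ 0`:
`P_{i+1}` is finer than `Pᵢ`, `Q_{i+1}` is finer than `Qᵢ`, and `Pᵢ` is finer
than `Q_{i+1}`. -/
theorem stmt_3
    (hfact : ∀ {A B : C} (f : A ⟶ B), ∃ (I : C) (e : A ⟶ I) (m : I ⟶ B),
      Nonempty (RegularEpi e) ∧ Mono m ∧ e ≫ m = f)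
    (hmono : ∀ {A B : C} (f : A ⟶ B), Mono f → Mono (H.map f))
    (hK0 : IsTerminal (K 0))
    (k : ∀ i : ℕ, XmodP H ξ K q i ⟶ K (i + 1))
    (hq : ∀ i : ℕ, q (i + 1) = kappaP H ξ K q i ≫ k i) :
    ∀ i : ℕ,
      Finer (Pmor H ξ K q (i + 1)) (Pmor H ξ K q i) ∧
      Finer (Qmor K q (i + 1)) (Qmor K q i) ∧
      Finer (Pmor H ξ K q i) (Qmor K q (i + 1)) := by
  intro i
  refine ⟨finer_Pmor H ξ K q i.le_succ, finer_Qmor K q i.le_succ, .Qmor_of_forall K q ?_⟩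
  rintro (_ | j) hj
  · exact hK0.hom_ext _ _
  · rw [hq j]
    exact (finer_Pmor H ξ K q (Nat.le_of_succ_le_succ hj)).comp_coequalizer_eq (k j)

end
end

section
/- In the generic partition refinement setup, for every i ≥ 0 there exists a unique morphism ξ/Q_i : X/P_i → H(X/Q_i) such that (ξ/Q_i) ∘ κ_{P_i} = H(κ_{Q_i}) ∘ ξ. -/
open CategoryTheory CategoryTheory.Limits

universe v u

noncomputable section

variable {C : Type u} [Category.{v} C] [HasFiniteLimits C] [HasCoequalizers C]

variable (H : C ⥤ C) {X : C} (ξ : X ⟶ H.obj X) (K : ℕ → C) (q : ∀ i : ℕ, X ⟶ K i)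

/-- If `f = e ≫ m` with `e` a regular epimorphism, then every morphism that coequalizes the kernel
pair of `f` factors through `e`. -/
theorem exists_fac_of_regularEpi_comp_eq {D : Type u} [Category.{v} D] [HasPullbacks D]
    {A I B Z : D} {f : A ⟶ B} {e : A ⟶ I} {m : I ⟶ B}
    (he : RegularEpi e) (hem : e ≫ m = f) (g : A ⟶ Z)
    (hg : pullback.fst f f ≫ g = pullback.snd f f ≫ g) : ∃ t : I ⟶ Z, e ≫ t = g := by
  have hf : he.left ≫ f = he.right ≫ f := by
    rw [← hem, he.w_assoc]
  have hlr : he.left ≫ g = he.right ≫ g := by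
    have := congrArg (fun x => pullback.lift he.left he.right hf ≫ x) hg
    simpa only [pullback.lift_fst_assoc, pullback.lift_snd_assoc] using this
  exact ⟨(he.desc' g hlr).1, (he.desc' g hlr).2⟩

/-- **Quotient structure on `X/Pᵢ`.**  In the generic partition refinement setup,
for every `i ≥ 0` there is a unique morphism `ξ/Qᵢ : X/Pᵢ ⟶ H(X/Qᵢ)` such that
`(ξ/Qᵢ) ∘ κ_{Pᵢ} = H(κ_{Qᵢ}) ∘ ξ`. -/
theorem stmt_4
    (hfact : ∀ {A B : C} (f : A ⟶ B), ∃ (I : C) (e : A ⟶ I) (m : I ⟶ B),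
      Nonempty (RegularEpi e) ∧ Mono m ∧ e ≫ m = f)
    (hmono : ∀ {A B : C} (f : A ⟶ B), Mono f → Mono (H.map f))
    (hK0 : IsTerminal (K 0))
    (k : ∀ i : ℕ, XmodP H ξ K q i ⟶ K (i + 1))
    (hq : ∀ i : ℕ, q (i + 1) = kappaP H ξ K q i ≫ k i) :
    ∀ i : ℕ,
      ∃! ξQ : XmodP H ξ K q i ⟶ H.obj (XmodQ K q i),
        kappaP H ξ K q i ≫ ξQ = ξ ≫ H.map (kappaQ K q i) := by
  intro i
  obtain ⟨I, e, m, ⟨he⟩, hm, hem⟩ := hfact (qbar K q i)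
  have hHm : Mono (H.map m) := hmono m hm
  obtain ⟨t, ht⟩ := exists_fac_of_regularEpi_comp_eq (f := Qmor K q i) he hem (kappaQ K q i)
    (coequalizer.condition _ _)
  have hker : pullback.fst (Pmor H ξ K q i) (Pmor H ξ K q i) ≫ ξ ≫ H.map e =
      pullback.snd (Pmor H ξ K q i) (Pmor H ξ K q i) ≫ ξ ≫ H.map e := by
    have hP : ξ ≫ H.map e ≫ H.map m = Pmor H ξ K q i := by
      rw [← H.map_comp, hem, Pmor]
    rw [← cancel_mono (H.map m)]
    simp only [Category.assoc, hP]
    exact pullback.condition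
  have hcoeq : pullback.fst (Pmor H ξ K q i) (Pmor H ξ K q i) ≫ ξ ≫ H.map (kappaQ K q i) =
      pullback.snd (Pmor H ξ K q i) (Pmor H ξ K q i) ≫ ξ ≫ H.map (kappaQ K q i) := by
    simpa only [← ht, H.map_comp, Category.assoc] using congrArg (· ≫ H.map t) hker
  refine ⟨coequalizer.desc _ hcoeq, coequalizer.π_desc _ _, fun y hy => ?_⟩
  exact coequalizer.hom_ext (hy.trans (coequalizer.π_desc _ hcoeq).symm)

end
end

section
/- In the generic partition refinement setup, let h : (X,ξ) → (D,d) be a coalgebra morphism whose underlying morphism is a regular epimorphism (a quotient of (X,ξ)). Then for every i ≥ 0, the kernel pair of h is finer than P_i and finer than Q_i. -/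
open CategoryTheory CategoryTheory.Limits

universe v u

noncomputable section

variable {C : Type u} [Category.{v} C] [HasFiniteLimits C] [HasCoequalizers C]

variable (H : C ⥤ C) {X : C} (ξ : X ⟶ H.obj X) (K : ℕ → C) (q : ∀ i : ℕ, X ⟶ K i)

omit [HasCoequalizers C] in
theorem finer_of_factors {X A B : C} {f : X ⟶ A} {g : X ⟶ B} (u : A ⟶ B)
    (hu : f ≫ u = g) : Finer f g :=
  ⟨pullback.lift (pullback.fst f f) (pullback.snd f f)
    (by rw [← hu, pullback.condition_assoc]),
    pullback.lift_fst _ _ _, pullback.lift_snd _ _ _⟩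

omit [HasCoequalizers C] in
theorem exists_qbar_factor {D : C} {h : X ⟶ D} {i : ℕ}
    (hf : ∀ j ≤ i, ∃ u : D ⟶ K j, h ≫ u = q j) :
    ∃ u : D ⟶ ∏ᶜ (fun j : Fin (i + 1) => K j), h ≫ u = qbar K q i := by
  choose u hu using hf
  refine ⟨Pi.lift fun j => u j (Nat.le_of_lt_succ j.2), Pi.hom_ext _ _ fun j => ?_⟩
  simp [qbar, hu]

omit [HasCoequalizers C] in
theorem exists_Pmor_factor {D : C} {d : D ⟶ H.obj D} {h : X ⟶ D}
    (hcoalg : h ≫ d = ξ ≫ H.map h) {i : ℕ}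
    (hf : ∃ u : D ⟶ ∏ᶜ (fun j : Fin (i + 1) => K j), h ≫ u = qbar K q i) :
    ∃ u : D ⟶ H.obj (∏ᶜ (fun j : Fin (i + 1) => K j)), h ≫ u = Pmor H ξ K q i := by
  obtain ⟨u, hu⟩ := hf
  refine ⟨d ≫ H.map u, ?_⟩
  rw [← Category.assoc, hcoalg, Category.assoc, ← H.map_comp, hu, Pmor]

theorem exists_kappaP_factor {D : C} {h : X ⟶ D} (hre : RegularEpi h) {i : ℕ}
    (hf : ∃ u : D ⟶ H.obj (∏ᶜ (fun j : Fin (i + 1) => K j)), h ≫ u = Pmor H ξ K q i) :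
    ∃ u : D ⟶ XmodP H ξ K q i, h ≫ u = kappaP H ξ K q i := by
  obtain ⟨u, hu⟩ := hf
  have hp : hre.left ≫ Pmor H ξ K q i = hre.right ≫ Pmor H ξ K q i := by
    rw [← hu, ← Category.assoc, hre.w, Category.assoc]
  have hk : hre.left ≫ kappaP H ξ K q i = hre.right ≫ kappaP H ξ K q i := by
    have := pullback.lift hre.left hre.right hp ≫= coequalizer.condition
      (pullback.fst (Pmor H ξ K q i) (Pmor H ξ K q i))
      (pullback.snd (Pmor H ξ K q i) (Pmor H ξ K q i))
    rwa [pullback.lift_fst_assoc, pullback.lift_snd_assoc] at this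
  exact ⟨Cofork.IsColimit.desc hre.isColimit _ hk, Cofork.IsColimit.π_desc' hre.isColimit _ hk⟩

/-- **Soundness.**  In the generic partition refinement setup, if
`h : (X,ξ) → (D,d)` is a quotient of the coalgebra `(X,ξ)` (a coalgebra morphism
carried by a regular epimorphism), then for every `i ≥ 0` the kernel pair of `h`
is finer than `Pᵢ` and finer than `Qᵢ`. -/
theorem stmt_5
    (hfact : ∀ {A B : C} (f : A ⟶ B), ∃ (I : C) (e : A ⟶ I) (m : I ⟶ B),
      Nonempty (RegularEpi e) ∧ Mono m ∧ e ≫ m = f)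
    (hmono : ∀ {A B : C} (f : A ⟶ B), Mono f → Mono (H.map f))
    (hK0 : IsTerminal (K 0))
    (k : ∀ i : ℕ, XmodP H ξ K q i ⟶ K (i + 1))
    (hq : ∀ i : ℕ, q (i + 1) = kappaP H ξ K q i ≫ k i)
    (D : C) (d : D ⟶ H.obj D) (h : X ⟶ D)
    (hcoalg : h ≫ d = ξ ≫ H.map h)
    (hre : Nonempty (RegularEpi h)) :
    ∀ i : ℕ, Finer h (Pmor H ξ K q i) ∧ Finer h (Qmor K q i) := by
  have hf : ∀ i, ∃ u : D ⟶ K i, h ≫ u = q i := by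
    intro i
    induction i using Nat.strong_induction_on with
    | _ i ih =>
      cases i with
      | zero => exact ⟨hK0.from D, hK0.hom_ext _ _⟩
      | succ i =>
        obtain ⟨u, hu⟩ := exists_kappaP_factor H ξ K q hre.some
          (exists_Pmor_factor H ξ K q hcoalg
            (exists_qbar_factor K q fun j hj => ih j (Nat.lt_succ_of_le hj)))
        exact ⟨u ≫ k i, by rw [← Category.assoc, hu, hq]⟩
  intro i
  obtain ⟨u, hu⟩ := exists_qbar_factor K q (i := i) fun j _ => hf j
  obtain ⟨w, hw⟩ := exists_Pmor_factor H ξ K q hcoalg ⟨u, hu⟩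
  exact ⟨finer_of_factors w hw, finer_of_factors u hu⟩

end
end

section
/- In the generic partition refinement setup, suppose that for some i the kernel pairs P_i and Q_i coincide (each is finer than the other, i.e., they represent the same subobject of X × X). Then there is a unique coalgebra structure d : X/Q_i → H(X/Q_i) making κ_{Q_i} : (X,ξ) → (X/Q_i, d) a coalgebra morphism, and the coalgebra (X/Q_i, d) is simple (every quotient of it is an isomorphism). -/
open CategoryTheory CategoryTheory.Limits

universe v u

noncomputable section

variable {C : Type u} [Category.{v} C] [HasFiniteLimits C] [HasCoequalizers C]

variable (H : C ⥤ C) {X : C} (ξ : X ⟶ H.obj X) (K : ℕ → C) (q : ∀ i : ℕ, X ⟶ K i)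

/-- A regular epimorphism is a coequalizer of its own kernel pair. -/
theorem exists_factor_of_regularEpi {D : Type*} [Category* D] [HasPullbacks D]
    {A B Z : D} {f : A ⟶ B} (hf : RegularEpi f) (h : A ⟶ Z)
    (w : pullback.fst f f ≫ h = pullback.snd f f ≫ h) : ∃ u : B ⟶ Z, f ≫ u = h := by
  have hw : hf.left ≫ h = hf.right ≫ h := by
    have := pullback.lift hf.left hf.right hf.w ≫= w
    simpa only [pullback.lift_fst_assoc, pullback.lift_snd_assoc] using this
  exact ⟨_, (RegularEpi.desc' hf h hw).2⟩

/-- If every morphism factors as a regular epimorphism followed by a monomorphism,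
then strong epimorphisms are regular. -/
theorem nonempty_regularEpi_of_strongEpi {D : Type*} [Category* D]
    (hfact : ∀ {A B : D} (f : A ⟶ B), ∃ (I : D) (e : A ⟶ I) (m : I ⟶ B),
      Nonempty (RegularEpi e) ∧ Mono m ∧ e ≫ m = f)
    {A B : D} (f : A ⟶ B) [StrongEpi f] : Nonempty (RegularEpi f) := by
  obtain ⟨I, e, m, ⟨he⟩, hm, rfl⟩ := hfact f
  have : StrongEpi m := strongEpi_of_strongEpi e m
  have : IsIso m := isIso_of_mono_of_strongEpi m
  exact ⟨RegularEpi.ofArrowIso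
    (Arrow.isoMk (f := Arrow.mk e) (g := Arrow.mk (e ≫ m)) (Iso.refl _) (asIso m)) he⟩

/-- The image of `f` is the quotient by its kernel pair. -/
theorem exists_mono_coequalizer_kernelPair
    (hfact : ∀ {A B : C} (f : A ⟶ B), ∃ (I : C) (e : A ⟶ I) (m : I ⟶ B),
      Nonempty (RegularEpi e) ∧ Mono m ∧ e ≫ m = f)
    {A B : C} (f : A ⟶ B) :
    ∃ m : coequalizer (pullback.fst f f) (pullback.snd f f) ⟶ B,
      Mono m ∧ coequalizer.π _ _ ≫ m = f := by
  obtain ⟨I, e, m, ⟨he⟩, hm, hem⟩ := hfact f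
  have hfe : pullback.fst f f ≫ e = pullback.snd f f ≫ e := by
    rw [← cancel_mono m, Category.assoc, Category.assoc, hem, pullback.condition]
  have hef : pullback.fst e e ≫ f = pullback.snd e e ≫ f := by
    rw [← hem, pullback.condition_assoc]
  obtain ⟨u, hu⟩ := exists_factor_of_regularEpi he
    (coequalizer.π (pullback.fst f f) (pullback.snd f f)) (by
      have := pullback.lift _ _ hef ≫= coequalizer.condition (pullback.fst f f) (pullback.snd f f)
      simpa only [pullback.lift_fst_assoc, pullback.lift_snd_assoc] using this)
  have hsplit : coequalizer.desc e hfe ≫ u = 𝟙 _ := by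
    apply coequalizer.hom_ext
    rw [coequalizer.π_desc_assoc, hu, Category.comp_id]
  have : Mono (coequalizer.desc e hfe ≫ u) := by rw [hsplit]; infer_instance
  have : Mono (coequalizer.desc e hfe) := mono_of_mono _ u
  exact ⟨coequalizer.desc e hfe ≫ m, mono_comp _ _, by rw [coequalizer.π_desc_assoc, hem]⟩

/-- Every block function of the refinement factors through any regular epimorphism carrying
a coalgebra morphism out of `(X, ξ)`. -/
theorem exists_factor_of_coalgebra_quotient
    (hK0 : IsTerminal (K 0))
    (k : ∀ i : ℕ, XmodP H ξ K q i ⟶ K (i + 1))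
    (hq : ∀ i : ℕ, q (i + 1) = kappaP H ξ K q i ≫ k i)
    {E : C} (dE : E ⟶ H.obj E) {f : X ⟶ E} (hf : RegularEpi f)
    (hcoalg : f ≫ dE = ξ ≫ H.map f) (i : ℕ) : ∃ u : E ⟶ K i, f ≫ u = q i := by
  induction i using Nat.strong_induction_on with
  | _ i ih =>
  cases i with
  | zero => exact ⟨hK0.from E, hK0.hom_ext _ _⟩
  | succ i =>
    choose u hu using fun j : Fin (i + 1) => ih j j.2
    have hbar : f ≫ Pi.lift u = qbar K q i := by
      apply Pi.hom_ext
      intro j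
      simp [qbar, hu]
    have hP : Pmor H ξ K q i = f ≫ dE ≫ H.map (Pi.lift u) := by
      rw [Pmor, ← hbar, H.map_comp, reassoc_of% hcoalg]
    have hfP : pullback.fst f f ≫ Pmor H ξ K q i = pullback.snd f f ≫ Pmor H ξ K q i := by
      rw [hP, pullback.condition_assoc]
    obtain ⟨w, hw⟩ := exists_factor_of_regularEpi hf (kappaP H ξ K q i) (by
      have := pullback.lift _ _ hfP ≫= coequalizer.condition
        (pullback.fst (Pmor H ξ K q i) (Pmor H ξ K q i)) (pullback.snd _ _)
      simp only [pullback.lift_fst_assoc, pullback.lift_snd_assoc] at this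
      exact this)
    exact ⟨w ≫ k i, by rw [hq, reassoc_of% hw]⟩

/-- **Correctness upon termination.**  In the generic partition refinement setup,
if for some `i` the kernel pairs `Pᵢ` and `Qᵢ` coincide (each is finer than the other),
then there is a unique coalgebra structure `d : X/Qᵢ ⟶ H(X/Qᵢ)` making
`κ_{Qᵢ} : (X,ξ) → (X/Qᵢ, d)` a coalgebra morphism, and the coalgebra `(X/Qᵢ, d)` is
simple: every quotient of it (coalgebra morphism carried by a regular epimorphism)
is an isomorphism. -/
theorem stmt_6
    (hfact : ∀ {A B : C} (f : A ⟶ B), ∃ (I : C) (e : A ⟶ I) (m : I ⟶ B),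
      Nonempty (RegularEpi e) ∧ Mono m ∧ e ≫ m = f)
    (hmono : ∀ {A B : C} (f : A ⟶ B), Mono f → Mono (H.map f))
    (hK0 : IsTerminal (K 0))
    (k : ∀ i : ℕ, XmodP H ξ K q i ⟶ K (i + 1))
    (hq : ∀ i : ℕ, q (i + 1) = kappaP H ξ K q i ≫ k i)
    (i : ℕ)
    (hPQ : Finer (Pmor H ξ K q i) (Qmor K q i) ∧ Finer (Qmor K q i) (Pmor H ξ K q i)) :
    ∃ d : XmodQ K q i ⟶ H.obj (XmodQ K q i),
      kappaQ K q i ≫ d = ξ ≫ H.map (kappaQ K q i) ∧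
      (∀ d' : XmodQ K q i ⟶ H.obj (XmodQ K q i),
        kappaQ K q i ≫ d' = ξ ≫ H.map (kappaQ K q i) → d' = d) ∧
      (∀ (E : C) (dE : E ⟶ H.obj E) (g : XmodQ K q i ⟶ E),
        g ≫ dE = d ≫ H.map g → Nonempty (RegularEpi g) → IsIso g) := by
  obtain ⟨m, hm, hκm⟩ : ∃ m : XmodQ K q i ⟶ _, Mono m ∧ kappaQ K q i ≫ m = Qmor K q i :=
    exists_mono_coequalizer_kernelPair hfact (Qmor K q i)
  have hκ : RegularEpi (kappaQ K q i) := coequalizerRegular _ _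
  have hHm : Mono (H.map m) := hmono m hm
  have hκξ : (ξ ≫ H.map (kappaQ K q i)) ≫ H.map m = Pmor H ξ K q i := by
    rw [Category.assoc, ← H.map_comp, hκm]; rfl
  obtain ⟨r, hr₁, hr₂⟩ := hPQ.2
  have hw : pullback.fst (Qmor K q i) (Qmor K q i) ≫ ξ ≫ H.map (kappaQ K q i) =
      pullback.snd (Qmor K q i) (Qmor K q i) ≫ ξ ≫ H.map (kappaQ K q i) := by
    rw [← cancel_mono (H.map m), Category.assoc (pullback.fst _ _),
      Category.assoc (pullback.snd _ _), hκξ, ← hr₁, ← hr₂,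
      Category.assoc, Category.assoc, pullback.condition]
  obtain ⟨d, hd⟩ : ∃ d : XmodQ K q i ⟶ H.obj (XmodQ K q i),
      kappaQ K q i ≫ d = ξ ≫ H.map (kappaQ K q i) :=
    ⟨coequalizer.desc _ hw, coequalizer.π_desc _ hw⟩
  have : IsRegularEpi (kappaQ K q i) := ⟨⟨hκ⟩⟩
  refine ⟨d, hd, fun d' hd' => ?_, fun E dE g hg hgreg => ?_⟩
  · rw [← cancel_epi (kappaQ K q i), hd', hd]
  have : IsRegularEpi g := ⟨hgreg⟩
  have : StrongEpi (kappaQ K q i ≫ g) := strongEpi_comp _ _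
  obtain ⟨hf⟩ := nonempty_regularEpi_of_strongEpi hfact (kappaQ K q i ≫ g)
  have hcoalg : (kappaQ K q i ≫ g) ≫ dE = ξ ≫ H.map (kappaQ K q i ≫ g) := by
    rw [Category.assoc, hg, reassoc_of% hd, H.map_comp]
  choose u hu using exists_factor_of_coalgebra_quotient H ξ K q hK0 k hq dE hf hcoalg
  have hgm : g ≫ Pi.lift (fun j : Fin (i + 1) => u j) = m := by
    rw [← cancel_epi (kappaQ K q i), hκm]
    apply Pi.hom_ext
    intro j
    simpa [Qmor, qbar] using hu j
  have : Mono (g ≫ Pi.lift (fun j : Fin (i + 1) => u j)) := by rwa [hgm]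
  have : Mono g := mono_of_mono g (Pi.lift (fun j : Fin (i + 1) => u j))
  exact isIso_of_mono_of_strongEpi g

end
end

section
/- In the generic partition refinement setup, for every i ≥ 0 the following are equivalent: (a) the kernel pairs Q_{i+1} and Q_i coincide (each is finer than the other), i.e., the algorithm fails to progress at step i+1; (b) q_{i+1} factors through κ_{Q_i} : X → X/Q_i, i.e., the select routine discards all new information at step i+1. -/
open CategoryTheory CategoryTheory.Limits

universe v u

noncomputable section

variable {C : Type u} [Category.{v} C] [HasFiniteLimits C] [HasCoequalizers C]

variable (H : C ⥤ C) {X : C} (ξ : X ⟶ H.obj X) (K : ℕ → C) (q : ∀ i : ℕ, X ⟶ K i)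

/-- The kernel pair of `f` is finer than that of `g` iff `g` coequalizes the kernel pair of `f`. -/
theorem finer_iff {X A B : C} (f : X ⟶ A) (g : X ⟶ B) :
    Finer f g ↔ pullback.fst f f ≫ g = pullback.snd f f ≫ g := by
  constructor
  · rintro ⟨m, h₁, h₂⟩
    rw [← h₁, ← h₂, Category.assoc, Category.assoc, pullback.condition]
  · intro h
    exact ⟨pullback.lift _ _ h, pullback.lift_fst _ _ _, pullback.lift_snd _ _ _⟩

/-- A pair of morphisms is equalized by `q̄ᵢ` iff it is equalized by every component. -/
theorem comp_qbar_eq_iff {X : C} (K : ℕ → C) (q : ∀ i : ℕ, X ⟶ K i) (i : ℕ) {T : C}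
    (a b : T ⟶ X) :
    a ≫ qbar K q i = b ≫ qbar K q i ↔ ∀ j ≤ i, a ≫ q j = b ≫ q j := by
  constructor
  · intro h j hj
    have hπ := congrArg
      (· ≫ Pi.π (fun j : Fin (i + 1) => K j) ⟨j, Nat.lt_succ_of_le hj⟩) h
    simpa [qbar] using hπ
  · intro h
    refine Pi.hom_ext _ _ fun j => ?_
    simpa [qbar] using h j (Nat.le_of_lt_succ j.2)

/-- **Progress characterization.**  In the generic partition refinement setup, for
every `i ≥ 0` the following are equivalent: (a) the kernel pairs `Q_{i+1}` and `Qᵢ`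
coincide (each is finer than the other), i.e. the algorithm fails to progress at step
`i+1`; (b) `q_{i+1}` factors through `κ_{Qᵢ} : X ⟶ X/Qᵢ`, i.e. the select routine
discards all new information at step `i+1`. -/
theorem stmt_8
    (hfact : ∀ {A B : C} (f : A ⟶ B), ∃ (I : C) (e : A ⟶ I) (m : I ⟶ B),
      Nonempty (RegularEpi e) ∧ Mono m ∧ e ≫ m = f)
    (hmono : ∀ {A B : C} (f : A ⟶ B), Mono f → Mono (H.map f))
    (hK0 : IsTerminal (K 0))
    (k : ∀ i : ℕ, XmodP H ξ K q i ⟶ K (i + 1))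
    (hq : ∀ i : ℕ, q (i + 1) = kappaP H ξ K q i ≫ k i) :
    ∀ i : ℕ,
      (Finer (Qmor K q (i + 1)) (Qmor K q i) ∧ Finer (Qmor K q i) (Qmor K q (i + 1))) ↔
        ∃ g : XmodQ K q i ⟶ K (i + 1), q (i + 1) = kappaQ K q i ≫ g := by
  intro i
  have hcond := (comp_qbar_eq_iff K q i _ _).1 (pullback.condition (f := Qmor K q i))
  constructor
  · rintro ⟨-, h⟩
    rw [finer_iff] at h
    have hlast := (comp_qbar_eq_iff K q (i + 1) _ _).1 h (i + 1) le_rfl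
    exact ⟨coequalizer.desc _ hlast, (coequalizer.π_desc _ _).symm⟩
  · rintro ⟨g, hg⟩
    rw [finer_iff, finer_iff]
    refine ⟨(comp_qbar_eq_iff K q i _ _).2 fun j hj => ?_,
      (comp_qbar_eq_iff K q (i + 1) _ _).2 fun j hj => ?_⟩
    · exact (comp_qbar_eq_iff K q (i + 1) _ _).1
        (pullback.condition (f := Qmor K q (i + 1))) j (Nat.le_succ_of_le hj)
    · rcases Nat.le_succ_iff.1 hj with hj | rfl
      · exact hcond j hj
      · have hκ : pullback.fst (Qmor K q i) (Qmor K q i) ≫ kappaQ K q i =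
            pullback.snd (Qmor K q i) (Qmor K q i) ≫ kappaQ K q i :=
          coequalizer.condition _ _
        rw [Nat.succ_eq_add_one, hg, ← Category.assoc, hκ, Category.assoc]

end
end

section
/- Let Y be a finite set, k a natural number, and for each 0 ≤ i < k let Q_i be an equivalence relation on Y and S_i ⊆ C_i ⊆ Y subsets such that: C_i is an equivalence class of Q_i; 2·|S_i| ≤ |C_i|; and Q_{i+1} = Q_i ∩ ker χ_{S_i}^{C_i}, i.e., y Q_{i+1} y' if and only if y Q_i y' and χ_{S_i}^{C_i}(y) = χ_{S_i}^{C_i}(y'). Then for every y ∈ Y, the number of indices i < k with y ∈ S_i is at most log₂|Y| (equivalently, 2^{|{i < k | y ∈ S_i}|} ≤ |Y|). -/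
universe u

/-- **Logarithmic bound on subblock membership ("process the smaller half").**
Let `Y` be a finite set and, for `0 ≤ i < k`, let `Q i` be an equivalence relation on
`Y` and `S i ⊆ C i ⊆ Y` be such that `C i` is an equivalence class of `Q i`,
`2·|S i| ≤ |C i|`, and `Q (i+1)` is the intersection of `Q i` with the kernel of
`χ_{S i}^{C i} : Y → {0,1,2}`.  Then every `y ∈ Y` belongs to at most `log₂ |Y|` of the
subblocks `S i`, i.e. `2 ^ |{i < k | y ∈ S i}| ≤ |Y|`. -/
theorem stmt_19 {Y : Type u} [Fintype Y] [DecidableEq Y] (k : ℕ)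
    (Q : ℕ → Y → Y → Prop) (S C : ℕ → Finset Y)
    (hQ : ∀ i ≤ k, Equivalence (Q i))
    (hSC : ∀ i < k, S i ⊆ C i)
    (hclass : ∀ i < k, ∃ y : Y, ∀ y' : Y, y' ∈ C i ↔ Q i y y')
    (hsize : ∀ i < k, 2 * (S i).card ≤ (C i).card)
    (hstep : ∀ i < k, ∀ y y' : Y,
      Q (i + 1) y y' ↔ Q i y y' ∧
        ((if y ∈ S i then 2 else if y ∈ C i then 1 else 0 : Fin 3) =
          (if y' ∈ S i then 2 else if y' ∈ C i then 1 else 0))) :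
    ∀ y : Y, 2 ^ ((Finset.range k).filter (fun i => y ∈ S i)).card ≤ Fintype.card Y := by
  classical
  intro y
  have key : ∀ n ≤ k, 2 ^ ((Finset.range n).filter (fun i => y ∈ S i)).card *
      (Finset.univ.filter (fun y' => Q n y y')).card ≤ Fintype.card Y := by
    intro n
    induction n with
    | zero =>
      intro _
      simpa using Finset.card_le_univ (Finset.univ.filter (fun y' => Q 0 y y'))
    | succ n ih =>
      intro hn
      have ih := ih (by omega)
      have hlt : n < k := by omega
      rw [Finset.range_add_one, Finset.filter_insert]
      by_cases hy : y ∈ S n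
      · rw [if_pos hy, Finset.card_insert_of_notMem (by simp), pow_succ]
        have hsub : Finset.univ.filter (fun y' => Q (n + 1) y y') ⊆ S n := by
          intro z hz
          have h := ((hstep n hlt y z).1 (Finset.mem_filter.1 hz).2).2
          by_contra hzS
          rw [if_pos hy, if_neg hzS] at h
          split_ifs at h <;> exact absurd h (by decide)
        have hC : C n ⊆ Finset.univ.filter (fun y' => Q n y y') := by
          intro z hz
          obtain ⟨x, hx⟩ := hclass n hlt
          have hE := hQ n hlt.le
          exact Finset.mem_filter.2 ⟨Finset.mem_univ z,
            hE.trans (hE.symm ((hx y).1 (hSC n hlt hy))) ((hx z).1 hz)⟩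
        have h1 := Finset.card_le_card hsub
        have h2 := Finset.card_le_card hC
        have h3 := hsize n hlt
        rw [mul_assoc]
        exact (Nat.mul_le_mul_left _ (by omega)).trans ih
      · rw [if_neg hy]
        refine (Nat.mul_le_mul_left _ (Finset.card_le_card ?_)).trans ih
        intro z hz
        exact Finset.mem_filter.2 ⟨Finset.mem_univ z,
          ((hstep n hlt y z).1 (Finset.mem_filter.1 hz).2).1⟩
  have hpos : 0 < (Finset.univ.filter (fun y' => Q k y y')).card :=
    Finset.card_pos.2 ⟨y, Finset.mem_filter.2 ⟨Finset.mem_univ y, (hQ k le_rfl).refl y⟩⟩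
  exact (Nat.le_mul_of_pos_right _ hpos).trans (key k le_rfl)
end
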